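/- Bilinear product estimate via BMO^{-1}: if f, g ∈ Ẇ^{1,2}(ℝ³) ∩ BMO^{-1}(ℝ³), then fg ∈ L²(ℝ³) and ‖fg‖_{L²(ℝ³)} ≤ C (‖f‖_{Ẇ^{1,2}} ‖g‖_{BMO^{-1}} + ‖f‖_{BMO^{-1}} ‖g‖_{Ẇ^{1,2}}). -/

import Mathlib

open MeasureTheory
open scoped ENNReal NNReal

local notation "E3" => EuclideanSpace ℝ (Fin 3)

/-- The divergence of a vector field on `ℝ³`. -/
noncomputable def div3 (φ : E3 → E3) (x : E3) : ℝ :=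
  ∑ i : Fin 3, fderiv ℝ φ x (EuclideanSpace.single i 1) i

/-- The BMO seminorm: supremum over all balls of the mean oscillation. -/
noncomputable def bmoNorm (φ : E3 → E3) : ℝ≥0∞ :=
  ⨆ (c : E3) (r : ℝ) (_ : 0 < r),
    ⨍⁻ x in Metric.ball c r, ‖φ x - ⨍ y in Metric.ball c r, φ y‖₊ ∂volume

/-- The `BMO^{-1}` norm of `f : ℝ³ → ℝ`: the infimum of `‖φ‖_{BMO}` over all smooth
vector fields `φ` with `div φ = f`. -/
noncomputable def bmoInvNorm (f : E3 → ℝ) : ℝ≥0∞ :=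
  ⨅ (φ : E3 → E3) (_ : ContDiff ℝ (⊤ : ℕ∞) φ ∧ ∀ x, div3 φ x = f x), bmoNorm φ

section MaximalFunction

open Metric Module

variable {E : Type*} [NormedAddCommGroup E] [NormedSpace ℝ E] [FiniteDimensional ℝ E]
  [MeasurableSpace E] [BorelSpace E] (μ : Measure E) [μ.IsAddHaarMeasure]

/-- The weak type (1,1) inequality for the Hardy-Littlewood maximal function. -/
lemma measure_setOf_lt_maximal_le [Nontrivial E] {G : E → ℝ≥0∞} (hG : ∫⁻ y, G y ∂μ ≠ ∞)
    {t : ℝ} (ht : 0 < t) :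
    ENNReal.ofReal t * μ {x | ∃ r : ℝ, 0 < r ∧
        ENNReal.ofReal t * μ (closedBall x r) < ∫⁻ y in closedBall x r, G y ∂μ}
      ≤ ENNReal.ofReal (5 ^ finrank ℝ E) * ∫⁻ y, G y ∂μ := by
  set S := {x | ∃ r : ℝ, 0 < r ∧
        ENNReal.ofReal t * μ (closedBall x r) < ∫⁻ y in closedBall x r, G y ∂μ}
  choose! r hr hrG using fun x (hx : x ∈ S) => hx
  set V := μ (ball 0 1)
  have hV : V ≠ 0 := (measure_ball_pos μ _ one_pos).ne'
  have hV' : V ≠ ∞ := measure_ball_lt_top.ne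
  have ht' : ENNReal.ofReal t ≠ 0 := by simpa using ht
  set K := ((∫⁻ y, G y ∂μ) / (ENNReal.ofReal t * V)).toReal
  have hbound : ∀ x ∈ S, r x ≤ max 1 K := by
    intro x hx
    rcases le_total (r x) 1 with h1 | h1
    · exact le_max_of_le_left h1
    refine le_max_of_le_right ((le_self_pow₀ h1 (finrank_pos (R := ℝ) (M := E)).ne').trans ?_)
    have hfin : (∫⁻ y, G y ∂μ) / (ENNReal.ofReal t * V) ≠ ∞ :=
      (ENNReal.div_lt_top hG (mul_ne_zero ht' hV)).ne
    rw [← ENNReal.ofReal_le_iff_le_toReal hfin,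
      ENNReal.le_div_iff_mul_le (Or.inl (mul_ne_zero ht' hV))
        (Or.inl (ENNReal.mul_ne_top ENNReal.ofReal_ne_top hV'))]
    calc ENNReal.ofReal (r x ^ finrank ℝ E) * (ENNReal.ofReal t * V)
        = ENNReal.ofReal t * μ (closedBall x (r x)) := by
          rw [Measure.addHaar_closedBall μ x (hr x hx).le]; ring
      _ ≤ _ := (hrG x hx).le.trans (setLIntegral_le_lintegral _ _)
  obtain ⟨u, huS, hdisj, hcov⟩ :=
    Vitali.exists_disjoint_subfamily_covering_enlargement_closedBall S id r (max 1 K) hbound 5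
      (by norm_num)
  simp only [id] at hdisj hcov
  have hcount : u.Countable := hdisj.countable_of_nonempty_interior fun x hx =>
    (nonempty_ball.2 (hr x (huS hx))).mono ball_subset_interior_closedBall
  have hsub : S ⊆ ⋃ x ∈ u, closedBall x (5 * r x) := fun x hx => by
    obtain ⟨b, hb, hxb⟩ := hcov x hx
    exact Set.mem_biUnion hb (hxb (mem_closedBall_self (hr x hx).le))
  have := hcount.to_subtype
  calc ENNReal.ofReal t * μ S
      ≤ ENNReal.ofReal t * ∑' x : u, μ (closedBall (x : E) (5 * r x)) := by
        gcongr
        exact (measure_mono hsub).trans (measure_biUnion_le μ hcount _)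
    _ = ENNReal.ofReal (5 ^ finrank ℝ E) *
          ∑' x : u, ENNReal.ofReal t * μ (closedBall (x : E) (r x)) := by
        rw [← ENNReal.tsum_mul_left, ← ENNReal.tsum_mul_left]
        refine tsum_congr fun x => ?_
        rw [Measure.addHaar_closedBall_mul_of_pos μ _ (by norm_num),
          Measure.addHaar_closedBall_center μ (x : E) (r x)]
        ring
    _ ≤ ENNReal.ofReal (5 ^ finrank ℝ E) *
          ∑' x : u, ∫⁻ y in closedBall (x : E) (r x), G y ∂μ := by
        gcongr with x
        exact (hrG x (huS x.2)).le
    _ ≤ _ := by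
        rw [← lintegral_biUnion hcount (fun _ _ => measurableSet_closedBall) hdisj]
        gcongr
        exact Measure.restrict_le_self

/-- The weak type inequality at height `t` only sees the values of `F` above `t / 2`. -/
lemma measure_lt_le_of_maximal [Nontrivial E] {F : E → ℝ≥0∞} (hF : Measurable F)
    (hF2 : ∫⁻ y, F y ^ 2 ∂μ ≠ ∞) {t : ℝ} (ht : 0 < t) :
    ENNReal.ofReal t * μ {x | ∃ r : ℝ, 0 < r ∧
        ENNReal.ofReal t * μ (closedBall x r) < ∫⁻ y in closedBall x r, F y ∂μ}
      ≤ ENNReal.ofReal (2 * 5 ^ finrank ℝ E) *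
        ∫⁻ y, {y | ENNReal.ofReal (t / 2) < F y}.indicator F y ∂μ := by
  set A := {y | ENNReal.ofReal (t / 2) < F y}
  have hAm : MeasurableSet A := measurableSet_lt measurable_const hF
  have ht2 : ENNReal.ofReal (t / 2) ≠ 0 := by simpa using ht
  have htt : ENNReal.ofReal t = ENNReal.ofReal (t / 2) + ENNReal.ofReal (t / 2) := by
    rw [← ENNReal.ofReal_add (by positivity) (by positivity)]; ring_nf
  have hfin : ∫⁻ y, A.indicator F y ∂μ ≠ ∞ := by
    have : ENNReal.ofReal (t / 2) * ∫⁻ y, A.indicator F y ∂μ ≤ ∫⁻ y, F y ^ 2 ∂μ := by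
      rw [← lintegral_const_mul _ (hF.indicator hAm)]
      refine lintegral_mono fun y => ?_
      by_cases hy : y ∈ A
      · rw [Set.indicator_of_mem hy, sq]
        gcongr
        exact le_of_lt hy
      · simp [hy]
    intro h
    rw [h, ENNReal.mul_top ht2, top_le_iff] at this
    exact hF2 this
  have key := measure_setOf_lt_maximal_le μ hfin (half_pos ht)
  calc _ ≤ ENNReal.ofReal t * μ {x | ∃ r : ℝ, 0 < r ∧ ENNReal.ofReal (t / 2) *
          μ (closedBall x r) < ∫⁻ y in closedBall x r, A.indicator F y ∂μ} := by
        gcongr ENNReal.ofReal t * ?_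
        refine measure_mono ?_
        rintro x ⟨r, hr, hlt⟩
        refine ⟨r, hr, ?_⟩
        have hB : μ (closedBall x r) ≠ ∞ := measure_closedBall_lt_top.ne
        have h1 : ∫⁻ y in closedBall x r, F y ∂μ ≤ (∫⁻ y in closedBall x r, A.indicator F y ∂μ)
            + ENNReal.ofReal (t / 2) * μ (closedBall x r) := by
          rw [← setLIntegral_const, ← lintegral_add_right _ measurable_const]
          refine lintegral_mono fun y => ?_
          by_cases hy : y ∈ A
          · simp [hy]
          · simpa [hy] using not_lt.1 hy
        rw [htt, add_mul] at hlt
        exact lt_of_add_lt_add_right (hlt.trans_le h1)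
    _ = 2 * (ENNReal.ofReal (t / 2) * μ {x | ∃ r : ℝ, 0 < r ∧ ENNReal.ofReal (t / 2) *
          μ (closedBall x r) < ∫⁻ y in closedBall x r, A.indicator F y ∂μ}) := by
        rw [htt]; ring
    _ ≤ 2 * (ENNReal.ofReal (5 ^ finrank ℝ E) * ∫⁻ y, A.indicator F y ∂μ) := by gcongr
    _ = _ := by
        rw [ENNReal.ofReal_mul zero_le_two, ENNReal.ofReal_ofNat, mul_assoc]

/-- The strong type (2,2) inequality: a function dominated by the Hardy-Littlewood maximal
function of `F` is controlled in `L²` by `F`. -/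
lemma lintegral_sq_le_of_le_maximal [Nontrivial E] {F : E → ℝ≥0∞} (hF : Measurable F)
    (hF2 : ∫⁻ y, F y ^ 2 ∂μ ≠ ∞) {h : E → ℝ} (hh : Measurable h) (h0 : ∀ x, 0 ≤ h x)
    (hmax : ∀ x t, 0 < t → t < h x → ∃ r : ℝ, 0 < r ∧
      ENNReal.ofReal t * μ (closedBall x r) < ∫⁻ y in closedBall x r, F y ∂μ) :
    ∫⁻ x, ENNReal.ofReal (h x) ^ 2 ∂μ
      ≤ ENNReal.ofReal (8 * 5 ^ finrank ℝ E) * ∫⁻ y, F y ^ 2 ∂μ := by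
  have hset : MeasurableSet {p : ℝ × E | ENNReal.ofReal (p.1 / 2) < F p.2} :=
    measurableSet_lt (by fun_prop) (by fun_prop)
  have hind : Measurable (Function.uncurry fun (t : ℝ) (y : E) =>
      {y | ENNReal.ofReal (t / 2) < F y}.indicator F y) :=
    (hF.comp measurable_snd).indicator hset
  have hint : Measurable fun t : ℝ =>
      ∫⁻ y, {y | ENNReal.ofReal (t / 2) < F y}.indicator F y ∂μ := hind.lintegral_prod_right'
  calc ∫⁻ x, ENNReal.ofReal (h x) ^ 2 ∂μ = ∫⁻ x, ENNReal.ofReal (h x ^ (2 : ℝ)) ∂μ := by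
        refine lintegral_congr fun x => ?_
        rw [← ENNReal.ofReal_pow (h0 x)]; norm_num
    _ = ENNReal.ofReal 2 * ∫⁻ t in Set.Ioi 0,
          μ {a | t < h a} * ENNReal.ofReal (t ^ ((2 : ℝ) - 1)) :=
        lintegral_rpow_eq_lintegral_meas_lt_mul μ (Filter.Eventually.of_forall h0)
          hh.aemeasurable two_pos
    _ ≤ ENNReal.ofReal 2 * ∫⁻ t in Set.Ioi (0 : ℝ), ENNReal.ofReal (2 * 5 ^ finrank ℝ E) *
          ∫⁻ y, {y | ENNReal.ofReal (t / 2) < F y}.indicator F y ∂μ := by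
        gcongr ENNReal.ofReal 2 * ?_
        refine setLIntegral_mono' (measurableSet_Ioi (a := (0 : ℝ))) fun t ht => ?_
        rw [show (2 : ℝ) - 1 = 1 by norm_num, Real.rpow_one, mul_comm]
        refine le_trans ?_ (measure_lt_le_of_maximal μ hF hF2 ht)
        gcongr with x
        exact hmax x t ht
    _ = ENNReal.ofReal 2 * (ENNReal.ofReal (2 * 5 ^ finrank ℝ E) *
          ∫⁻ y, (∫⁻ t in Set.Ioi (0 : ℝ),
            {y | ENNReal.ofReal (t / 2) < F y}.indicator F y) ∂μ) := by
        rw [lintegral_const_mul _ hint,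
          lintegral_lintegral_swap hind.aemeasurable]
    _ ≤ ENNReal.ofReal 2 * (ENNReal.ofReal (2 * 5 ^ finrank ℝ E) *
          ∫⁻ y, 2 * F y ^ 2 ∂μ) := by
        gcongr with y
        calc ∫⁻ t in Set.Ioi (0 : ℝ), {y | ENNReal.ofReal (t / 2) < F y}.indicator F y
            = ∫⁻ t in Set.Ioi (0 : ℝ),
                {t : ℝ | ENNReal.ofReal (t / 2) < F y}.indicator (fun _ => F y) t := rfl
          _ ≤ F y * (volume.restrict (Set.Ioi 0)) {t : ℝ | ENNReal.ofReal (t / 2) < F y} :=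
              lintegral_indicator_const_le _ _
          _ ≤ F y * (2 * F y) := by
              gcongr
              rcases eq_or_ne (F y) ∞ with hy | hy
              · simp [hy]
              calc _ ≤ volume (Set.Ioo 0 (2 * (F y).toReal)) := by
                    rw [Measure.restrict_apply' measurableSet_Ioi]
                    refine measure_mono fun t ht => ⟨ht.2, ?_⟩
                    have := (ENNReal.ofReal_lt_iff_lt_toReal
                      (by have := ht.2.out; positivity) hy).1 ht.1
                    linarith
                _ = _ := by
                    rw [Real.volume_Ioo, sub_zero, ENNReal.ofReal_mul zero_le_two,
                      ENNReal.ofReal_toReal hy, ENNReal.ofReal_ofNat]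
          _ = 2 * F y ^ 2 := by ring
    _ = _ := by
        have hc : ENNReal.ofReal (8 * 5 ^ finrank ℝ E)
            = 2 * ENNReal.ofReal (2 * 5 ^ finrank ℝ E) * 2 := by
          rw [show (8 : ℝ) * 5 ^ finrank ℝ E = 2 * (2 * 5 ^ finrank ℝ E) * 2 by ring,
            ENNReal.ofReal_mul (by positivity), ENNReal.ofReal_mul zero_le_two,
            ENNReal.ofReal_ofNat]
        rw [lintegral_const_mul _ (by fun_prop), hc, ENNReal.ofReal_ofNat]
        ring

end MaximalFunction

section PseudoPoincare

open Metric Module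

variable {E : Type*} [NormedAddCommGroup E] [NormedSpace ℝ E] [FiniteDimensional ℝ E]
  [MeasurableSpace E] [BorelSpace E] (μ : Measure E) [μ.IsAddHaarMeasure]

lemma setLIntegral_closedBall_comp_homothety {F : E → ℝ≥0∞} (hF : Measurable F) (x : E)
    {s : ℝ} (hs : 0 < s) (R : ℝ) :
    ∫⁻ y in closedBall x R, F (x + s • (y - x)) ∂μ
      = ENNReal.ofReal (s ^ finrank ℝ E)⁻¹ * ∫⁻ z in closedBall x (s * R), F z ∂μ := by
  set g : E → ℝ≥0∞ := (closedBall 0 (s * R)).indicator fun w => F (x + w)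
  have hg : Measurable g := (hF.comp (measurable_const_add x)).indicator measurableSet_closedBall
  calc ∫⁻ y in closedBall x R, F (x + s • (y - x)) ∂μ
      = ∫⁻ y, g (s • (y - x)) ∂μ := by
        rw [← lintegral_indicator measurableSet_closedBall]
        refine lintegral_congr fun y => ?_
        have : y ∈ closedBall x R ↔ s • (y - x) ∈ closedBall (0 : E) (s * R) := by
          rw [mem_closedBall_zero_iff, norm_smul, Real.norm_of_nonneg hs.le,
            mul_le_mul_iff_right₀ hs, mem_closedBall_iff_norm]
        simp only [g]
        by_cases hy : y ∈ closedBall x R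
        · rw [Set.indicator_of_mem hy, Set.indicator_of_mem (this.1 hy)]
        · rw [Set.indicator_of_notMem hy, Set.indicator_of_notMem (mt this.2 hy)]
    _ = ∫⁻ w, g (s • w) ∂μ := lintegral_sub_right_eq_self (fun w => g (s • w)) x
    _ = ENNReal.ofReal (s ^ finrank ℝ E)⁻¹ * ∫⁻ w, g w ∂μ := by
        rw [← lintegral_map hg (measurable_const_smul s), Measure.map_addHaar_smul μ hs.ne',
          lintegral_smul_measure, abs_of_pos (by positivity), smul_eq_mul]
    _ = ENNReal.ofReal (s ^ finrank ℝ E)⁻¹ * ∫⁻ z, g (z - x) ∂μ := by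
        rw [lintegral_sub_right_eq_self g x]
    _ = _ := by
        rw [← lintegral_indicator measurableSet_closedBall]
        congr 1
        refine lintegral_congr fun z => ?_
        simp only [g]
        by_cases hz : z ∈ closedBall x (s * R)
        · rw [Set.indicator_of_mem hz, Set.indicator_of_mem (by simpa [dist_eq_norm] using hz)]
          simp
        · rw [Set.indicator_of_notMem hz,
            Set.indicator_of_notMem (by simpa [dist_eq_norm] using hz)]

lemma enorm_sub_le_lintegral_fderiv {f : E → ℝ} (hf : ContDiff ℝ 1 f) (x y : E) :
    ‖f y - f x‖ₑ ≤ ‖y - x‖ₑ * ∫⁻ s in Set.Ioc (0 : ℝ) 1, ‖fderiv ℝ f (x + s • (y - x))‖ₑ := by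
  have hcont : Continuous (fderiv ℝ f) := hf.continuous_fderiv one_ne_zero
  have hderiv (s : ℝ) : HasDerivAt (fun s : ℝ => f (x + s • (y - x)))
      (fderiv ℝ f (x + s • (y - x)) (y - x)) s := by
    have h1 : HasDerivAt (fun s : ℝ => x + s • (y - x)) (y - x) s := by
      simpa using ((hasDerivAt_id s).smul_const (y - x)).const_add x
    exact ((hf.differentiable one_ne_zero).differentiableAt.hasFDerivAt).comp_hasDerivAt s h1
  have hftc := intervalIntegral.integral_eq_sub_of_hasDerivAt (a := 0) (b := 1)
    (fun s _ => hderiv s) (Continuous.intervalIntegrable (by fun_prop) _ _)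
  simp only [one_smul, add_sub_cancel, zero_smul, add_zero] at hftc
  rw [← hftc, intervalIntegral.integral_of_le zero_le_one, ← lintegral_const_mul _ (by fun_prop)]
  refine (enorm_integral_le_lintegral_enorm _).trans (lintegral_mono fun s => ?_)
  rw [mul_comm]
  exact (fderiv ℝ f (x + s • (y - x))).le_opENorm (y - x)

lemma setLIntegral_enorm_sub_le {f : E → ℝ} (hf : ContDiff ℝ 1 f) {x : E} {t : ℝ≥0∞}
    (ht : ∀ r : ℝ, 0 < r →
      ∫⁻ y in closedBall x r, ‖fderiv ℝ f y‖ₑ ∂μ ≤ t * μ (closedBall x r))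
    {R : ℝ} (hR : 0 < R) :
    ∫⁻ y in closedBall x R, ‖f y - f x‖ₑ ∂μ
      ≤ ENNReal.ofReal R * (t * μ (closedBall x R)) := by
  have hcont : Continuous (fderiv ℝ f) := hf.continuous_fderiv one_ne_zero
  calc ∫⁻ y in closedBall x R, ‖f y - f x‖ₑ ∂μ
      ≤ ∫⁻ y in closedBall x R, ENNReal.ofReal R *
          (∫⁻ s in Set.Ioc (0 : ℝ) 1, ‖fderiv ℝ f (x + s • (y - x))‖ₑ) ∂μ := by
        refine setLIntegral_mono' measurableSet_closedBall fun y hy => ?_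
        refine (enorm_sub_le_lintegral_fderiv hf x y).trans ?_
        gcongr
        rw [← ofReal_norm]
        exact ENNReal.ofReal_le_ofReal (mem_closedBall_iff_norm.1 hy)
    _ = ENNReal.ofReal R * ∫⁻ s in Set.Ioc (0 : ℝ) 1,
          (∫⁻ y in closedBall x R, ‖fderiv ℝ f (x + s • (y - x))‖ₑ ∂μ) := by
        rw [lintegral_const_mul' _ _ ENNReal.ofReal_ne_top, lintegral_lintegral_swap]
        exact Continuous.aemeasurable (by unfold Function.uncurry; fun_prop)
    _ ≤ ENNReal.ofReal R * ∫⁻ s in Set.Ioc (0 : ℝ) 1, t * μ (closedBall x R) := by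
        gcongr ENNReal.ofReal R * ?_
        refine setLIntegral_mono' measurableSet_Ioc fun s hs => ?_
        have hpow : 0 < s ^ finrank ℝ E := pow_pos hs.1 _
        rw [setLIntegral_closedBall_comp_homothety μ (F := fun z => ‖fderiv ℝ f z‖ₑ)
          (by fun_prop) x hs.1 R]
        calc _ ≤ ENNReal.ofReal (s ^ finrank ℝ E)⁻¹ * (t * μ (closedBall x (s * R))) := by
              gcongr
              exact ht _ (mul_pos hs.1 hR)
          _ = (ENNReal.ofReal (s ^ finrank ℝ E)⁻¹ * ENNReal.ofReal (s ^ finrank ℝ E)) *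
                (t * μ (closedBall x R)) := by
              rw [Measure.addHaar_closedBall_mul_of_pos μ x hs.1,
                Measure.addHaar_closedBall_center μ x]
              ring
          _ = t * μ (closedBall x R) := by
              rw [← ENNReal.ofReal_mul (by positivity), inv_mul_cancel₀ hpow.ne',
                ENNReal.ofReal_one, one_mul]
    _ = _ := by simp

end PseudoPoincare

section BMOInv

open Metric

/-- Integration by parts for the divergence; the field may be shifted by a constant. -/
lemma integral_div3_mul {Φ : E3 → E3} (hΦ : ContDiff ℝ 1 Φ) {η : E3 → ℝ} (hη : ContDiff ℝ 1 η)
    (hηs : HasCompactSupport η) (c : E3) :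
    ∫ y, div3 Φ y * η y = - ∫ y, fderiv ℝ η y (Φ y - c) := by
  have hcη : Continuous (fderiv ℝ η) := hη.continuous_fderiv one_ne_zero
  have hcΦ : Continuous (fderiv ℝ Φ) := hΦ.continuous_fderiv one_ne_zero
  have hη' : HasCompactSupport (fderiv ℝ η) := hηs.fderiv ℝ
  have hcomp (i : Fin 3) : ContDiff ℝ 1 fun y => (Φ y - c) i :=
    (EuclideanSpace.proj (𝕜 := ℝ) i).contDiff.comp (hΦ.sub contDiff_const)
  have hder (i : Fin 3) (y v : E3) :
      fderiv ℝ (fun y => (Φ y - c) i) y v = fderiv ℝ Φ y v i := by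
    have h1 : HasFDerivAt (fun y => Φ y - c) (fderiv ℝ Φ y) y :=
      ((hΦ.differentiable one_ne_zero).differentiableAt.hasFDerivAt).sub_const c
    have h2 : HasFDerivAt (fun y => (Φ y - c) i) _ y :=
      (EuclideanSpace.proj (𝕜 := ℝ) i).hasFDerivAt.comp y h1
    rw [h2.fderiv]
    rfl
  have hi1 (i : Fin 3) :
      Integrable fun y => fderiv ℝ Φ y (EuclideanSpace.single i 1) i * η y :=
    Continuous.integrable_of_hasCompactSupport
      (((EuclideanSpace.proj (𝕜 := ℝ) i).continuous.comp (by fun_prop)).mul hη.continuous)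
      hηs.mul_left
  have hi2 (i : Fin 3) :
      Integrable fun y => (Φ y - c) i * fderiv ℝ η y (EuclideanSpace.single i 1) :=
    Continuous.integrable_of_hasCompactSupport
      ((hcomp i).continuous.mul (by fun_prop))
      (hη'.comp_left (g := fun L : E3 →L[ℝ] ℝ => L (EuclideanSpace.single i 1)) rfl).mul_left
  have hi3 (i : Fin 3) : Integrable fun y => (Φ y - c) i * η y :=
    Continuous.integrable_of_hasCompactSupport ((hcomp i).continuous.mul hη.continuous)
      hηs.mul_left
  have hparts (i : Fin 3) := integral_mul_fderiv_eq_neg_fderiv_mul_of_integrable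
    (μ := (volume : Measure E3)) (f := fun y => (Φ y - c) i) (g := η)
    (v := EuclideanSpace.single i 1) (by simpa only [hder] using hi1 i) (hi2 i) (hi3 i)
    (fun y _ => ((hcomp i).differentiable one_ne_zero).differentiableAt)
    (fun y _ => (hη.differentiable one_ne_zero).differentiableAt)
  simp only [hder] at hparts
  have hexp (y : E3) : fderiv ℝ η y (Φ y - c)
      = ∑ i, (Φ y - c) i * fderiv ℝ η y (EuclideanSpace.single i 1) := by
    conv_lhs => rw [← (EuclideanSpace.basisFun (Fin 3) ℝ).sum_repr (Φ y - c)]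
    simp [map_sum]
  simp only [hexp, div3, Finset.sum_mul]
  rw [integral_finsetSum _ fun i _ => hi1 i, integral_finsetSum _ fun i _ => hi2 i,
    ← Finset.sum_neg_distrib]
  exact Finset.sum_congr rfl fun i _ => by rw [hparts i, neg_neg]

lemma setLIntegral_oscillation_le (Φ : E3 → E3) (x : E3) {R : ℝ} (hR : 0 < R) :
    ∫⁻ y in ball x R, ‖Φ y - ⨍ z in ball x R, Φ z‖ₑ ≤ bmoNorm Φ * volume (ball x R) := by
  have h : ⨍⁻ y in ball x R, ‖Φ y - ⨍ z in ball x R, Φ z‖ₑ ∂volume ≤ bmoNorm Φ :=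
    le_iSup_of_le x (le_iSup_of_le R (le_iSup_of_le hR le_rfl))
  rwa [setLAverage_eq, ENNReal.div_le_iff (measure_ball_pos _ _ hR).ne'
    measure_ball_lt_top.ne] at h

/-- The pointwise bound `|f| ≤ A (R M(∇f) + R⁻¹ ‖f‖_{BMO⁻¹})`, from comparing `f` with its
average against a bump function at scale `R`. -/
lemma exists_abs_le_scale : ∃ A : ℝ, 0 < A ∧ ∀ (f : E3 → ℝ) (Φ : E3 → E3), ContDiff ℝ 1 f →
    ContDiff ℝ 1 Φ → (∀ x, div3 Φ x = f x) → ∀ (b t : ℝ), 0 ≤ b → 0 ≤ t →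
    bmoNorm Φ ≤ ENNReal.ofReal b → ∀ x : E3,
    (∀ r : ℝ, 0 < r → ∫⁻ y in closedBall x r, ‖fderiv ℝ f y‖ₑ
      ≤ ENNReal.ofReal t * volume (closedBall x r)) →
    ∀ R : ℝ, 0 < R → |f x| ≤ A * (R * t + b / R) := by
  let η : ContDiffBump (0 : E3) := ⟨1 / 4, 1 / 2, by norm_num, by norm_num⟩
  have hηc : ContDiff ℝ 1 η := η.contDiff
  obtain ⟨K, hK⟩ := (hηc.continuous_fderiv one_ne_zero).bounded_above_of_compact_support
    (η.hasCompactSupport.fderiv ℝ)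
  have hK0 : 0 ≤ K := (norm_nonneg _).trans (hK 0)
  set N := ∫ y, η y
  have hN : 0 < N := η.integral_pos
  set V := volume.real (ball (0 : E3) 1)
  have hV : 0 < V :=
    ENNReal.toReal_pos (measure_ball_pos _ _ one_pos).ne' measure_ball_lt_top.ne
  refine ⟨V / N * (1 + K), by positivity, fun f Φ hf hΦ hdiv b t hb ht hbmo x hM R hR => ?_⟩
  set ηR : E3 → ℝ := fun y => η (R⁻¹ • (y - x)) with hηR
  have hηRc : ContDiff ℝ 1 ηR := hηc.comp ((contDiff_id.sub contDiff_const).const_smul R⁻¹)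
  have hηR0 {y : E3} (hy : y ∉ ball x R) : R⁻¹ • (y - x) ∉ tsupport η := by
    rw [η.tsupport_eq, mem_closedBall_zero_iff, norm_smul, norm_inv, Real.norm_of_nonneg hR.le]
    rw [mem_ball_iff_norm, not_lt] at hy
    have : 1 ≤ R⁻¹ * ‖y - x‖ := by
      rw [← inv_mul_cancel₀ hR.ne']; gcongr
    have h12 : η.rOut = 1 / 2 := rfl
    rw [h12]
    linarith
  have hηRz {y : E3} (hy : y ∉ closedBall x R) : ηR y = 0 :=
    image_eq_zero_of_notMem_tsupport (f := η) (hηR0 (mt (fun h => ball_subset_closedBall h) hy))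
  have hηRs : HasCompactSupport ηR :=
    HasCompactSupport.intro (isCompact_closedBall x R) fun y hy => hηRz hy
  have hder (y : E3) : fderiv ℝ ηR y = R⁻¹ • fderiv ℝ η (R⁻¹ • (y - x)) := by
    have h1 : HasFDerivAt (fun y : E3 => R⁻¹ • (y - x)) (R⁻¹ • ContinuousLinearMap.id ℝ E3) y :=
      ((hasFDerivAt_id y).sub_const x).const_smul R⁻¹
    have h2 := ((hηc.differentiable one_ne_zero).differentiableAt
      (x := R⁻¹ • (y - x))).hasFDerivAt.comp y h1
    rw [show ηR = η ∘ fun y : E3 => R⁻¹ • (y - x) from rfl, h2.fderiv]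
    ext v
    simp
  have hηRint : ∫ y, ηR y = R ^ 3 * N := by
    rw [hηR, integral_sub_right_eq_self (fun y => η (R⁻¹ • y)) x,
      Measure.integral_comp_inv_smul volume η R]
    simp [abs_of_pos hR, N]
  have hvol : volume (ball x R) = ENNReal.ofReal (R ^ 3 * V) := by
    rw [Measure.addHaar_ball _ _ hR.le, ENNReal.ofReal_mul (by positivity),
      ofReal_measureReal measure_ball_lt_top.ne]
    simp
  have hgrad : ‖∫ y, (f y - f x) * ηR y‖ₑ ≤ ENNReal.ofReal (R * (t * (R ^ 3 * V))) := by
    calc _ ≤ ∫⁻ y, ‖(f y - f x) * ηR y‖ₑ := enorm_integral_le_lintegral_enorm _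
      _ ≤ ∫⁻ y in closedBall x R, ‖f y - f x‖ₑ := by
          rw [← lintegral_indicator measurableSet_closedBall]
          refine lintegral_mono fun y => ?_
          by_cases hy : y ∈ closedBall x R
          · rw [Set.indicator_of_mem hy, enorm_mul]
            refine mul_le_of_le_one_right' ?_
            rw [Real.enorm_of_nonneg η.nonneg]
            exact ENNReal.ofReal_le_one.2 η.le_one
          · simp [hηRz hy]
      _ ≤ _ := setLIntegral_enorm_sub_le volume hf hM hR
      _ = _ := by
          rw [Measure.addHaar_closedBall_eq_addHaar_ball, hvol, ← ENNReal.ofReal_mul ht,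
            ← ENNReal.ofReal_mul hR.le]
  have hosc : ‖∫ y, f y * ηR y‖ₑ ≤ ENNReal.ofReal (K / R * (b * (R ^ 3 * V))) := by
    simp only [← hdiv]
    rw [integral_div3_mul hΦ hηRc hηRs (⨍ z in ball x R, Φ z), enorm_neg]
    calc _ ≤ ∫⁻ y, ‖fderiv ℝ ηR y (Φ y - ⨍ z in ball x R, Φ z)‖ₑ :=
          enorm_integral_le_lintegral_enorm _
      _ ≤ ∫⁻ y in ball x R, ENNReal.ofReal (K / R) * ‖Φ y - ⨍ z in ball x R, Φ z‖ₑ := by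
          rw [← lintegral_indicator measurableSet_ball]
          refine lintegral_mono fun y => ?_
          by_cases hy : y ∈ ball x R
          · rw [Set.indicator_of_mem hy]
            refine (ContinuousLinearMap.le_opENorm _ _).trans ?_
            gcongr
            rw [← ofReal_norm, hder, norm_smul, norm_inv, Real.norm_of_nonneg hR.le,
              div_eq_inv_mul]
            gcongr
            exact hK _
          · have : fderiv ℝ η (R⁻¹ • (y - x)) = 0 := by
              by_contra h
              exact hηR0 hy (support_fderiv_subset ℝ h)
            simp [hder, this]
      _ ≤ ENNReal.ofReal (K / R) * (ENNReal.ofReal b * volume (ball x R)) := by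
          rw [lintegral_const_mul' _ _ ENNReal.ofReal_ne_top]
          gcongr
          exact (setLIntegral_oscillation_le Φ x hR).trans (by gcongr)
      _ = _ := by
          rw [hvol, ← ENNReal.ofReal_mul hb, ← ENNReal.ofReal_mul (by positivity)]
  have hgrad' : |∫ y, (f y - f x) * ηR y| ≤ R * (t * (R ^ 3 * V)) := by
    rwa [← ofReal_norm, ENNReal.ofReal_le_ofReal_iff (by positivity)] at hgrad
  have hosc' : |∫ y, f y * ηR y| ≤ K / R * (b * (R ^ 3 * V)) := by
    rwa [← ofReal_norm, ENNReal.ofReal_le_ofReal_iff (by positivity)] at hosc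
  have hsplit : ∫ y, (f y - f x) * ηR y = (∫ y, f y * ηR y) - f x * (R ^ 3 * N) := by
    simp only [sub_mul]
    rw [integral_sub, integral_const_mul, hηRint]
    · exact (hf.continuous.mul hηRc.continuous).integrable_of_hasCompactSupport hηRs.mul_left
    · exact (hηRc.continuous.integrable_of_hasCompactSupport hηRs).const_mul _
  have hmain : |f x| * (R ^ 3 * N) ≤ R * (t * (R ^ 3 * V)) + K / R * (b * (R ^ 3 * V)) := by
    have hpos : 0 < R ^ 3 * N := by positivity
    rw [← abs_of_pos hpos, ← abs_mul, ← sub_sub_cancel (∫ y, f y * ηR y) (f x * (R ^ 3 * N)),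
      ← hsplit]
    refine (abs_sub _ _).trans ?_
    linarith
  have hR3 : 0 < R ^ 3 := by positivity
  have hmain' : |f x| * N ≤ V * (R * t + K * (b / R)) := by
    refine le_of_mul_le_mul_right ?_ hR3
    calc _ = |f x| * (R ^ 3 * N) := by ring
      _ ≤ _ := hmain
      _ = _ := by ring
  rw [div_mul_eq_mul_div, div_mul_eq_mul_div, le_div_iff₀ hN, mul_assoc]
  refine hmain'.trans ?_
  have h1 : 0 ≤ R * t := by positivity
  have h2 : 0 ≤ b / R := by positivity
  gcongr
  nlinarith [mul_nonneg hK0 h1]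

/-- Optimising the scale: `f² ≤ A M(∇f) ‖f‖_{BMO⁻¹}` pointwise. -/
lemma exists_sq_le_maximal : ∃ A : ℝ, 0 < A ∧ ∀ (f : E3 → ℝ) (b : ℝ),
    0 < b → bmoInvNorm f < ENNReal.ofReal b → ContDiff ℝ 1 f ∧ ∀ x t, 0 < t →
    t < f x ^ 2 / (A * b) → ∃ r : ℝ, 0 < r ∧
      ENNReal.ofReal t * volume (closedBall x r) < ∫⁻ y in closedBall x r, ‖fderiv ℝ f y‖ₑ := by
  obtain ⟨A, hA, hAf⟩ := exists_abs_le_scale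
  refine ⟨(2 * A) ^ 2, by positivity, fun f b hb hfb => ?_⟩
  obtain ⟨Φ, hΦ⟩ := iInf_lt_iff.1 hfb
  obtain ⟨⟨hΦs, hdiv⟩, hbmo⟩ := iInf_lt_iff.1 hΦ
  have hf : ContDiff ℝ 1 f := by
    have hD : ContDiff ℝ 1 (fderiv ℝ Φ) := hΦs.fderiv_right (by norm_cast)
    rw [show f = div3 Φ from funext fun x => (hdiv x).symm]
    exact ContDiff.sum fun i _ => (EuclideanSpace.proj (𝕜 := ℝ) i).contDiff.comp
      (hD.clm_apply contDiff_const)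
  refine ⟨hf, fun x t ht hlt => ?_⟩
  by_contra! hcon
  have hbound := hAf f Φ hf (hΦs.of_le (by norm_cast)) hdiv b t hb.le ht.le hbmo.le x hcon
    (√(b / t)) (by positivity)
  rw [lt_div_iff₀ (by positivity)] at hlt
  have hsq : √(b / t) * t + b / √(b / t) = 2 * √(b * t) := by
    rw [Real.sqrt_div hb.le, Real.sqrt_mul hb.le]
    have h1 := Real.sq_sqrt hb.le
    have h2 := Real.sq_sqrt ht.le
    have h3 : 0 < √b := by positivity
    have h4 : 0 < √t := by positivity
    generalize √b = u at *
    generalize √t = v at *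
    subst h1 h2
    field_simp
    ring
  rw [hsq] at hbound
  have := pow_le_pow_left₀ (abs_nonneg _) hbound 2
  rw [sq_abs, mul_pow, mul_pow, Real.sq_sqrt (by positivity)] at this
  nlinarith


lemma eLpNorm_two_sq {α F : Type*} [MeasurableSpace α] [NormedAddCommGroup F] (μ : Measure α)
    (f : α → F) : eLpNorm f 2 μ ^ 2 = ∫⁻ x, ‖f x‖ₑ ^ 2 ∂μ := by
  simpa using eLpNorm_nnreal_pow_eq_lintegral (f := f) (μ := μ) (p := 2) two_ne_zero

lemma exists_eLpNorm_sq_div_le : ∃ A : ℝ, 0 < A ∧ ∀ (f : E3 → ℝ) (b : ℝ),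
    eLpNorm (fun x => fderiv ℝ f x) 2 volume ≠ ⊤ → 0 < b → bmoInvNorm f < ENNReal.ofReal b →
    eLpNorm (fun x => f x ^ 2 / b) 2 volume
      ≤ ENNReal.ofReal A * eLpNorm (fun x => fderiv ℝ f x) 2 volume := by
  obtain ⟨A, hA, hAf⟩ := exists_sq_le_maximal
  refine ⟨A * 1000, by positivity, fun f b hfin hb hfb => ?_⟩
  obtain ⟨hf, hmax⟩ := hAf f b hb hfb
  have hcont : Continuous (fderiv ℝ f) := hf.continuous_fderiv one_ne_zero
  have hfin2 : ∫⁻ y, ‖fderiv ℝ f y‖ₑ ^ 2 ≠ ∞ := by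
    rw [← eLpNorm_two_sq]
    exact ENNReal.pow_ne_top hfin
  have key := lintegral_sq_le_of_le_maximal volume (F := fun y => ‖fderiv ℝ f y‖ₑ)
    (by fun_prop) hfin2 (h := fun x => f x ^ 2 / (A * b))
    (by have := hf.continuous; fun_prop) (fun x => by positivity) hmax
  have hh : eLpNorm (fun x => f x ^ 2 / (A * b)) 2 volume
      ≤ 1000 * eLpNorm (fun x => fderiv ℝ f x) 2 volume := by
    rw [← ENNReal.pow_le_pow_left_iff two_ne_zero, mul_pow, eLpNorm_two_sq, eLpNorm_two_sq]
    refine le_trans (le_of_eq (lintegral_congr fun x => ?_)) (key.trans ?_)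
    · rw [Real.enorm_of_nonneg (by positivity)]
    · gcongr
      rw [finrank_euclideanSpace, Fintype.card_fin]
      norm_num
  have hscale : (fun x => f x ^ 2 / b) = A • fun x => f x ^ 2 / (A * b) := by
    ext x
    simp only [Pi.smul_apply, smul_eq_mul]
    field_simp
  rw [hscale, eLpNorm_const_smul, Real.enorm_of_nonneg hA.le, ENNReal.ofReal_mul hA.le, mul_assoc]
  gcongr
  simpa using hh

lemma exists_eLpNorm_mul_le : ∃ C : ℝ, 0 < C ∧ ∀ (f g : E3 → ℝ) (a b : ℝ),
    Differentiable ℝ f → Differentiable ℝ g →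
    eLpNorm (fun x => fderiv ℝ f x) 2 volume ≠ ⊤ →
    eLpNorm (fun x => fderiv ℝ g x) 2 volume ≠ ⊤ → 0 < a → 0 < b →
    bmoInvNorm f < ENNReal.ofReal a → bmoInvNorm g < ENNReal.ofReal b →
    eLpNorm (fun x => f x * g x) 2 volume
      ≤ ENNReal.ofReal C *
          (eLpNorm (fun x => fderiv ℝ f x) 2 volume * ENNReal.ofReal b
            + ENNReal.ofReal a * eLpNorm (fun x => fderiv ℝ g x) 2 volume) := by
  obtain ⟨A, hA, hAf⟩ := exists_eLpNorm_sq_div_le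
  refine ⟨A, hA, fun f g a b hf hg hf2 hg2 ha hb hfa hgb => ?_⟩
  have hfc := hf.continuous
  have hgc := hg.continuous
  calc eLpNorm (fun x => f x * g x) 2 volume
      ≤ eLpNorm ((b • fun x => f x ^ 2 / a) + (a • fun x => g x ^ 2 / b)) 2 volume := by
        refine eLpNorm_mono fun x => ?_
        simp only [Pi.add_apply, Pi.smul_apply, smul_eq_mul]
        have h0 : 0 ≤ b * (f x ^ 2 / a) + a * (g x ^ 2 / b) := by positivity
        rw [Real.norm_of_nonneg h0, Real.norm_eq_abs, abs_mul]
        have hprod : b * (f x ^ 2 / a) * (a * (g x ^ 2 / b)) = (|f x| * |g x|) ^ 2 := by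
          rw [mul_pow, sq_abs, sq_abs]
          field_simp
        have h1 : 0 ≤ b * (f x ^ 2 / a) := by positivity
        have h2 : 0 ≤ a * (g x ^ 2 / b) := by positivity
        refine abs_le_of_sq_le_sq' ?_ h0 |>.2
        nlinarith
    _ ≤ eLpNorm (b • fun x => f x ^ 2 / a) 2 volume
          + eLpNorm (a • fun x => g x ^ 2 / b) 2 volume :=
        eLpNorm_add_le (Continuous.aestronglyMeasurable (by fun_prop))
          (Continuous.aestronglyMeasurable (by fun_prop)) one_le_two
    _ ≤ ENNReal.ofReal b * (ENNReal.ofReal A * eLpNorm (fun x => fderiv ℝ f x) 2 volume)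
          + ENNReal.ofReal a * (ENNReal.ofReal A * eLpNorm (fun x => fderiv ℝ g x) 2 volume) := by
        rw [eLpNorm_const_smul, eLpNorm_const_smul, Real.enorm_of_nonneg ha.le,
          Real.enorm_of_nonneg hb.le]
        gcongr
        · exact hAf f a hf2 ha hfa
        · exact hAf g b hg2 hb hgb
    _ = _ := by ring

end BMOInv

/-- if `f, g ∈ Ẇ^{1,2}(ℝ³) ∩ BMO^{-1}(ℝ³)`, then `fg ∈ L²(ℝ³)` and
`‖fg‖_{L²} ≤ C (‖f‖_{Ẇ^{1,2}} ‖g‖_{BMO^{-1}} + ‖f‖_{BMO^{-1}} ‖g‖_{Ẇ^{1,2}})`. -/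
theorem bilinear_L2_via_BMO_inv :
    ∃ C : ℝ, 0 < C ∧ ∀ f g : E3 → ℝ,
      Differentiable ℝ f → Differentiable ℝ g →
      eLpNorm (fun x => fderiv ℝ f x) 2 volume ≠ ⊤ →
      eLpNorm (fun x => fderiv ℝ g x) 2 volume ≠ ⊤ →
      bmoInvNorm f ≠ ⊤ → bmoInvNorm g ≠ ⊤ →
      eLpNorm (fun x => f x * g x) 2 volume
        ≤ ENNReal.ofReal C *
            (eLpNorm (fun x => fderiv ℝ f x) 2 volume * bmoInvNorm g
              + bmoInvNorm f * eLpNorm (fun x => fderiv ℝ g x) 2 volume) := by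
  obtain ⟨C, hC, hmul⟩ := exists_eLpNorm_mul_le
  refine ⟨C, hC, fun f g hf hg hf2 hg2 hfB hgB => ?_⟩
  set D₁ := eLpNorm (fun x => fderiv ℝ f x) 2 volume
  set D₂ := eLpNorm (fun x => fderiv ℝ g x) 2 volume
  have hadd {B : ℝ≥0∞} (hB : B ≠ ⊤) {ε : ℝ} (hε : 0 < ε) :
      ENNReal.ofReal (B.toReal + ε) = B + ENNReal.ofReal ε := by
    rw [ENNReal.ofReal_add ENNReal.toReal_nonneg hε.le, ENNReal.ofReal_toReal hB]
  have hlt {B : ℝ≥0∞} (hB : B ≠ ⊤) {ε : ℝ} (hε : 0 < ε) : B < ENNReal.ofReal (B.toReal + ε) := by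
    rw [hadd hB hε]
    exact ENNReal.lt_add_right hB (by simpa using hε)
  have hε (ε : ℝ) (hε : 0 < ε) : eLpNorm (fun x => f x * g x) 2 volume ≤
      ENNReal.ofReal C * (D₁ * bmoInvNorm g + bmoInvNorm f * D₂)
        + ENNReal.ofReal C * (D₁ + D₂) * ENNReal.ofReal ε := by
    refine (hmul f g _ _ hf hg hf2 hg2 (by positivity) (by positivity) (hlt hfB hε)
      (hlt hgB hε)).trans (le_of_eq ?_)
    rw [hadd hfB hε, hadd hgB hε]
    ring
  have hK : ENNReal.ofReal C * (D₁ + D₂) ≠ ⊤ :=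
    ENNReal.mul_ne_top ENNReal.ofReal_ne_top (ENNReal.add_ne_top.2 ⟨hf2, hg2⟩)
  have hlim : Filter.Tendsto (fun ε : ℝ => ENNReal.ofReal C * (D₁ * bmoInvNorm g
      + bmoInvNorm f * D₂) + ENNReal.ofReal C * (D₁ + D₂) * ENNReal.ofReal ε)
      (nhdsWithin 0 (Set.Ioi 0)) (nhds (ENNReal.ofReal C * (D₁ * bmoInvNorm g
        + bmoInvNorm f * D₂))) := by
    have h0 : Filter.Tendsto ENNReal.ofReal (nhdsWithin 0 (Set.Ioi 0)) (nhds 0) := by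
      simpa using (ENNReal.continuous_ofReal.tendsto 0).mono_left nhdsWithin_le_nhds
    simpa using (ENNReal.Tendsto.const_mul h0 (Or.inr hK)).const_add _
  exact ge_of_tendsto hlim (eventually_mem_nhdsWithin.mono hε)
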